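/- Let α ∈ [−1,1], r ≥ 1 an integer, and let c = (c_1,c_2) ∈ ℂ² and a = (a_1,…,a_5) ∈ ℂ⁵ be nonzero. If α ≠ −1 the function (t,ξ,x) ↦ (c_1 t^{r−1}e^{2(1+α)t} + c_2 t^{r−1})·(a_1 + a_2ξ + a_3x_1 + a_4x_2 + a_5x_1x_2) satisfies τ^r ≡ 0 and τ^{r−1} ≢ 0, and if α = −1 the function (t,ξ,x) ↦ (c_1 t^{2r−1} + c_2 t^{2r−2})·(a_1 + a_2ξ + a_3x_1 + a_4x_2 + a_5x_1x_2) satisfies τ^r ≡ 0 and τ^{r−1} ≢ 0; i.e. in both cases the function is proper r-harmonic on G_{4.8}^α. -/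

import Mathlib

open BigOperators

/-- Directional (partial) derivative of a complex-valued function along `v`. -/
noncomputable def pder {E : Type*} [NormedAddCommGroup E] [NormedSpace ℝ E]
    (v : E) (f : E → ℂ) (p : E) : ℂ :=
  fderiv ℝ f p v

/-- Unit coordinate vectors `(t, ξ, x₁, x₂)` on `G₄.₈^α = ℝ ⋉ H³`. -/
def eT : ℝ × ℝ × ℝ × ℝ := (1, 0, 0, 0)
def eXi : ℝ × ℝ × ℝ × ℝ := (0, 1, 0, 0)
def eX1 : ℝ × ℝ × ℝ × ℝ := (0, 0, 1, 0)
def eX2 : ℝ × ℝ × ℝ × ℝ := (0, 0, 0, 1)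

/-- The Laplace–Beltrami (tension) operator on `G₄.₈^α` in coordinates `(t,ξ,x₁,x₂)`:
`τ(φ) = ∂²φ/∂t² − 2(1+α)∂φ/∂t + (e^{2(1+α)t} + ¼(e^{2t}x₂² + e^{2αt}x₁²))∂²φ/∂ξ²`
`− e^{2t}x₂ ∂²φ/∂ξ∂x₁ + e^{2αt}x₁ ∂²φ/∂ξ∂x₂ + e^{2t}∂²φ/∂x₁² + e^{2αt}∂²φ/∂x₂²`. -/
noncomputable def tension48 (α : ℝ) (f : ℝ × ℝ × ℝ × ℝ → ℂ) (p : ℝ × ℝ × ℝ × ℝ) : ℂ :=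
  pder eT (pder eT f) p - (2 * (1 + α) : ℝ) * pder eT f p
    + ((Real.exp (2 * (1 + α) * p.1)
        + (1 / 4) * (Real.exp (2 * p.1) * p.2.2.2 ^ 2
            + Real.exp (2 * α * p.1) * p.2.2.1 ^ 2) : ℝ) : ℂ)
        * pder eXi (pder eXi f) p
    - ((Real.exp (2 * p.1) * p.2.2.2 : ℝ) : ℂ) * pder eXi (pder eX1 f) p
    + ((Real.exp (2 * α * p.1) * p.2.2.1 : ℝ) : ℂ) * pder eXi (pder eX2 f) p
    + ((Real.exp (2 * p.1) : ℝ) : ℂ) * pder eX1 (pder eX1 f) p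
    + ((Real.exp (2 * α * p.1) : ℝ) : ℂ) * pder eX2 (pder eX2 f) p

/-- The iterated Laplace–Beltrami operator on `G₄.₈^α`. -/
noncomputable def tension48Iter (α : ℝ) : ℕ → (ℝ × ℝ × ℝ × ℝ → ℂ) → (ℝ × ℝ × ℝ × ℝ → ℂ)
  | 0, f => f
  | r + 1, f => tension48 α (tension48Iter α r f)

open Polynomial

/-- The affine-bilinear factor `a₁ + a₂ξ + a₃x₁ + a₄x₂ + a₅x₁x₂`. -/
noncomputable def spatialFactor (a₁ a₂ a₃ a₄ a₅ : ℂ) (q : ℝ × ℝ × ℝ × ℝ) : ℂ :=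
  a₁ + a₂ * (q.2.1 : ℂ) + a₃ * (q.2.2.1 : ℂ) + a₄ * (q.2.2.2 : ℂ)
    + a₅ * (q.2.2.1 : ℂ) * (q.2.2.2 : ℂ)

lemma differentiable_spatialFactor (a₁ a₂ a₃ a₄ a₅ : ℂ) :
    Differentiable ℝ (spatialFactor a₁ a₂ a₃ a₄ a₅) := by
  have h : Differentiable ℝ (fun x : ℝ => (x : ℂ)) := Complex.ofRealCLM.differentiable
  have h₁ : Differentiable ℝ (fun q : ℝ × ℝ × ℝ × ℝ => (q.2.1 : ℂ)) :=
    h.comp (g := fun x : ℝ => (x : ℂ)) (by fun_prop)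
  have h₂ : Differentiable ℝ (fun q : ℝ × ℝ × ℝ × ℝ => (q.2.2.1 : ℂ)) :=
    h.comp (g := fun x : ℝ => (x : ℂ)) (by fun_prop)
  have h₃ : Differentiable ℝ (fun q : ℝ × ℝ × ℝ × ℝ => (q.2.2.2 : ℂ)) :=
    h.comp (g := fun x : ℝ => (x : ℂ)) (by fun_prop)
  unfold spatialFactor
  fun_prop

lemma pder_eq_of_hasDerivAt_line {E : Type*} [NormedAddCommGroup E] [NormedSpace ℝ E]
    {v : E} {f : E → ℂ} {p : E} {d : ℂ} (hf : DifferentiableAt ℝ f p)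
    (hd : HasDerivAt (fun s : ℝ => f (p + s • v)) d 0) : pder v f p = d :=
  (hf.hasFDerivAt.hasLineDerivAt v).unique hd

section Product

variable {f : ℝ → ℂ} (a₁ a₂ a₃ a₄ a₅ : ℂ)

lemma differentiable_mul_spatialFactor (hf : Differentiable ℝ f) :
    Differentiable ℝ (fun q => f q.1 * spatialFactor a₁ a₂ a₃ a₄ a₅ q) :=
  (hf.comp differentiable_fst).mul (differentiable_spatialFactor a₁ a₂ a₃ a₄ a₅)

lemma pder_eT_mul_spatialFactor {df : ℝ → ℂ} (hf : ∀ t, HasDerivAt f (df t) t) :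
    pder eT (fun q => f q.1 * spatialFactor a₁ a₂ a₃ a₄ a₅ q) =
      fun q => df q.1 * spatialFactor a₁ a₂ a₃ a₄ a₅ q := by
  funext p
  refine pder_eq_of_hasDerivAt_line (differentiable_mul_spatialFactor a₁ a₂ a₃ a₄ a₅
    (fun t => (hf t).differentiableAt) p) ?_
  have h : HasDerivAt (fun s : ℝ => f (p.1 + s)) (df p.1) 0 :=
    HasDerivAt.comp_const_add p.1 0 (by simpa using hf p.1)
  simpa [spatialFactor, eT] using h.mul_const (spatialFactor a₁ a₂ a₃ a₄ a₅ p)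

lemma hasDerivAt_ofReal_const_add (x : ℝ) :
    HasDerivAt (fun s : ℝ => (x : ℂ) + (s : ℂ)) 1 0 := by
  simpa using ((hasDerivAt_id (0 : ℝ)).ofReal_comp).const_add (x : ℂ)

lemma pder_eXi_mul_spatialFactor (hf : Differentiable ℝ f) :
    pder eXi (fun q => f q.1 * spatialFactor a₁ a₂ a₃ a₄ a₅ q) =
      fun q => f q.1 * spatialFactor a₂ 0 0 0 0 q := by
  funext p
  refine pder_eq_of_hasDerivAt_line
    (differentiable_mul_spatialFactor a₁ a₂ a₃ a₄ a₅ hf p) ?_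
  have h := (((((hasDerivAt_ofReal_const_add p.2.1).const_mul a₂).const_add a₁).add_const
    (a₃ * (p.2.2.1 : ℂ))).add_const (a₄ * (p.2.2.2 : ℂ))).add_const
    (a₅ * (p.2.2.1 : ℂ) * (p.2.2.2 : ℂ)) |>.const_mul (f p.1)
  simpa [spatialFactor, eXi] using h

lemma pder_eX1_mul_spatialFactor (hf : Differentiable ℝ f) :
    pder eX1 (fun q => f q.1 * spatialFactor a₁ a₂ a₃ a₄ a₅ q) =
      fun q => f q.1 * spatialFactor a₃ 0 0 a₅ 0 q := by
  funext p
  refine pder_eq_of_hasDerivAt_line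
    (differentiable_mul_spatialFactor a₁ a₂ a₃ a₄ a₅ hf p) ?_
  have hx := hasDerivAt_ofReal_const_add p.2.2.1
  have h := (((hx.const_mul a₃).const_add (a₁ + a₂ * (p.2.1 : ℂ))).add_const
    (a₄ * (p.2.2.2 : ℂ))).add ((hx.const_mul a₅).mul_const (p.2.2.2 : ℂ)) |>.const_mul (f p.1)
  simpa [spatialFactor, eX1] using h

lemma pder_eX2_mul_spatialFactor (hf : Differentiable ℝ f) :
    pder eX2 (fun q => f q.1 * spatialFactor a₁ a₂ a₃ a₄ a₅ q) =
      fun q => f q.1 * spatialFactor a₄ 0 a₅ 0 0 q := by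
  funext p
  refine pder_eq_of_hasDerivAt_line
    (differentiable_mul_spatialFactor a₁ a₂ a₃ a₄ a₅ hf p) ?_
  have hx := hasDerivAt_ofReal_const_add p.2.2.2
  have h := ((hx.const_mul a₄).const_add
    (a₁ + a₂ * (p.2.1 : ℂ) + a₃ * (p.2.2.1 : ℂ))).add
    (hx.const_mul (a₅ * (p.2.2.1 : ℂ))) |>.const_mul (f p.1)
  simpa [spatialFactor, eX2] using h

lemma tension48_mul_spatialFactor (α : ℝ) {df ddf : ℝ → ℂ}
    (hf : ∀ t, HasDerivAt f (df t) t) (hdf : ∀ t, HasDerivAt df (ddf t) t) :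
    tension48 α (fun q => f q.1 * spatialFactor a₁ a₂ a₃ a₄ a₅ q) =
      fun q => (ddf q.1 - (2 * (1 + α) : ℝ) * df q.1) * spatialFactor a₁ a₂ a₃ a₄ a₅ q := by
  have hd : Differentiable ℝ f := fun t => (hf t).differentiableAt
  funext p
  simp only [tension48, pder_eT_mul_spatialFactor _ _ _ _ _ hf,
    pder_eT_mul_spatialFactor _ _ _ _ _ hdf, pder_eXi_mul_spatialFactor _ _ _ _ _ hd,
    pder_eX1_mul_spatialFactor _ _ _ _ _ hd, pder_eX2_mul_spatialFactor _ _ _ _ _ hd]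
  simp only [spatialFactor]
  ring

end Product

/-- The operator `P ↦ ∂²P + κ ∂P` on polynomials. -/
noncomputable def derivTwist (κ : ℂ) : ℂ[X] →ₗ[ℂ] ℂ[X] :=
  derivative ^ 2 + κ • derivative

lemma derivTwist_apply (κ : ℂ) (P : ℂ[X]) :
    derivTwist κ P = derivative (derivative P) + C κ * derivative P := by
  simp [derivTwist, pow_two, smul_eq_C_mul]

lemma derivTwist_pow_eq_zero (κ : ℂ) {n : ℕ} {P : ℂ[X]} (hP : P.degree < n) :
    (derivTwist κ ^ n) P = 0 := by
  have h : derivTwist κ ^ n = (derivative + algebraMap ℂ _ κ) ^ n * derivative ^ n := by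
    rw [← Commute.mul_pow ((Commute.refl _).add_left (Algebra.commutes κ _))]
    simp [derivTwist, add_mul, pow_two, Algebra.smul_def]
  rw [h, Module.End.mul_apply, Module.End.pow_apply derivative,
    iterate_derivative_eq_zero_of_degree_lt hP, map_zero]

lemma derivTwist_pow_X_pow (κ : ℂ) (n : ℕ) :
    (derivTwist κ ^ n) (X ^ n) = C (κ ^ n * n.factorial) := by
  induction n with
  | zero => simp
  | succ n ih =>
    have h : derivTwist κ (X ^ (n + 1)) =
        derivative (C (n + 1 : ℂ) * X ^ n) + (κ * (n + 1)) • X ^ n := by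
      simp [derivTwist_apply, smul_eq_C_mul, mul_assoc]
    have h₀ : (derivTwist κ ^ n) (derivative (C (n + 1 : ℂ) * X ^ n)) = 0 := by
      apply derivTwist_pow_eq_zero
      rcases n with _ | n
      · simp
      · rw [derivative_C_mul_X_pow]
        exact (degree_C_mul_X_pow_le _ _).trans_lt (by norm_cast; omega)
    rw [pow_succ, Module.End.mul_apply, h, map_add, h₀, map_smul, ih, zero_add,
      smul_eq_C_mul, ← C_mul, Nat.factorial_succ]
    congr 1
    push_cast
    ring

lemma derivTwist_zero_pow (n : ℕ) (P : ℂ[X]) :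
    (derivTwist 0 ^ n) P = derivative^[2 * n] P := by
  rw [derivTwist, zero_smul, add_zero, ← pow_mul, Module.End.pow_apply]

/-- The function `t ↦ P(t) e^{κt} + Q(t)`. -/
noncomputable def expPoly (κ : ℝ) (P Q : ℂ[X]) (t : ℝ) : ℂ :=
  P.eval (t : ℂ) * (Real.exp (κ * t) : ℂ) + Q.eval (t : ℂ)

lemma hasDerivAt_expPoly (κ : ℝ) (P Q : ℂ[X]) (t : ℝ) :
    HasDerivAt (expPoly κ P Q) (expPoly κ (derivative P + C (κ : ℂ) * P) (derivative Q) t) t := by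
  have hP := (P.hasDerivAt (t : ℂ)).comp_ofReal
  have hQ := (Q.hasDerivAt (t : ℂ)).comp_ofReal
  have hE := (((hasDerivAt_id t).const_mul κ).exp).ofReal_comp
  refine ((hP.mul hE).add hQ).congr_deriv ?_
  simp only [expPoly, eval_add, eval_mul, eval_C, id]
  push_cast
  ring

lemma tension48_expPoly (α : ℝ) (P Q : ℂ[X]) (a₁ a₂ a₃ a₄ a₅ : ℂ) :
    tension48 α (fun q => expPoly (2 * (1 + α)) P Q q.1 * spatialFactor a₁ a₂ a₃ a₄ a₅ q) =
      fun q => expPoly (2 * (1 + α)) (derivTwist (2 * (1 + α) : ℝ) P)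
        (derivTwist (-(2 * (1 + α) : ℝ)) Q) q.1 * spatialFactor a₁ a₂ a₃ a₄ a₅ q := by
  rw [tension48_mul_spatialFactor _ _ _ _ _ _ (hasDerivAt_expPoly _ _ _)
    (hasDerivAt_expPoly _ _ _)]
  funext q
  congr 1
  simp only [expPoly, derivTwist_apply, map_add, derivative_C_mul, eval_add, eval_mul, eval_C,
    map_neg, eval_neg]
  ring

lemma tension48Iter_expPoly (α : ℝ) (n : ℕ) (P Q : ℂ[X]) (a₁ a₂ a₃ a₄ a₅ : ℂ) :
    tension48Iter α n
        (fun q => expPoly (2 * (1 + α)) P Q q.1 * spatialFactor a₁ a₂ a₃ a₄ a₅ q) =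
      fun q => expPoly (2 * (1 + α)) ((derivTwist (2 * (1 + α) : ℝ) ^ n) P)
        ((derivTwist (-(2 * (1 + α) : ℝ)) ^ n) Q) q.1 * spatialFactor a₁ a₂ a₃ a₄ a₅ q := by
  induction n with
  | zero => simp [tension48Iter]
  | succ n ih =>
    rw [tension48Iter, ih, tension48_expPoly]
    simp only [pow_succ', Module.End.mul_apply]

lemma exists_spatialFactor_ne_zero {a₁ a₂ a₃ a₄ a₅ : ℂ}
    (ha : ¬ (a₁ = 0 ∧ a₂ = 0 ∧ a₃ = 0 ∧ a₄ = 0 ∧ a₅ = 0)) :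
    ∃ y : ℝ × ℝ × ℝ, ∀ t, spatialFactor a₁ a₂ a₃ a₄ a₅ (t, y) ≠ 0 := by
  by_contra! h
  have key : ∀ x y z : ℝ, spatialFactor a₁ a₂ a₃ a₄ a₅ (0, x, y, z) = 0 := fun x y z => by
    obtain ⟨t, ht⟩ := h (x, y, z)
    simpa [spatialFactor] using ht
  have h₁ := key 0 0 0
  have h₂ := key 1 0 0
  have h₃ := key 0 1 0
  have h₄ := key 0 0 1
  have h₅ := key 0 1 1
  simp only [spatialFactor] at h₁ h₂ h₃ h₄ h₅
  push_cast at h₁ h₂ h₃ h₄ h₅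
  apply ha
  refine ⟨?_, ?_, ?_, ?_, ?_⟩ <;> grind

lemma exists_mul_exp_add_ne_zero {κ : ℝ} (hκ : κ ≠ 0) {b₁ b₂ : ℂ} (hb : ¬ (b₁ = 0 ∧ b₂ = 0)) :
    ∃ t : ℝ, b₁ * (Real.exp (κ * t) : ℂ) + b₂ ≠ 0 := by
  by_contra! h
  have h₀ := h 0
  have h₁ := h (1 / κ)
  rw [mul_one_div_cancel hκ] at h₁
  simp only [mul_zero, Real.exp_zero, Complex.ofReal_one, mul_one] at h₀
  have he : (Real.exp 1 : ℂ) - 1 ≠ 0 := by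
    have := Real.add_one_lt_exp one_ne_zero
    rw [sub_ne_zero]
    norm_cast
    linarith
  have hm : b₁ * ((Real.exp 1 : ℂ) - 1) = 0 := by linear_combination h₁ - h₀
  have hz : b₁ = 0 := (mul_eq_zero.mp hm).resolve_right he
  exact hb ⟨hz, by simpa [hz] using h₀⟩

lemma exists_mul_add_ne_zero {b₁ b₂ : ℂ} (hb : ¬ (b₁ = 0 ∧ b₂ = 0)) :
    ∃ t : ℝ, b₁ * (t : ℂ) + b₂ ≠ 0 := by
  by_contra! h
  have h₀ : b₂ = 0 := by simpa using h 0
  exact hb ⟨by simpa [h₀] using h 1, h₀⟩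

/-- Example 5.7. For `α ∈ [−1,1]`, `r ≥ 1`, and nonzero `c ∈ ℂ²`,
`a ∈ ℂ⁵`: if `α ≠ −1` the function
`(t,ξ,x) ↦ (c₁ t^{r−1}e^{2(1+α)t} + c₂ t^{r−1})(a₁ + a₂ξ + a₃x₁ + a₄x₂ + a₅x₁x₂)`
is proper `r`-harmonic, and if `α = −1` the function
`(t,ξ,x) ↦ (c₁ t^{2r−1} + c₂ t^{2r−2})(a₁ + a₂ξ + a₃x₁ + a₄x₂ + a₅x₁x₂)`
is proper `r`-harmonic on `G₄.₈^α`. -/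
theorem proper_r_harmonic_G48
    (α : ℝ) (hα : α ∈ Set.Icc (-1 : ℝ) 1)
    (r : ℕ) (hr : 1 ≤ r)
    (c₁ c₂ : ℂ) (hc : ¬ (c₁ = 0 ∧ c₂ = 0))
    (a₁ a₂ a₃ a₄ a₅ : ℂ) (ha : ¬ (a₁ = 0 ∧ a₂ = 0 ∧ a₃ = 0 ∧ a₄ = 0 ∧ a₅ = 0)) :
    (α ≠ -1 →
      (∀ p, tension48Iter α r
          (fun q => (c₁ * (q.1 : ℂ) ^ (r - 1) * (Real.exp (2 * (1 + α) * q.1) : ℂ)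
              + c₂ * (q.1 : ℂ) ^ (r - 1))
            * (a₁ + a₂ * (q.2.1 : ℂ) + a₃ * (q.2.2.1 : ℂ) + a₄ * (q.2.2.2 : ℂ)
                + a₅ * (q.2.2.1 : ℂ) * (q.2.2.2 : ℂ))) p = 0) ∧
      (∃ p, tension48Iter α (r - 1)
          (fun q => (c₁ * (q.1 : ℂ) ^ (r - 1) * (Real.exp (2 * (1 + α) * q.1) : ℂ)
              + c₂ * (q.1 : ℂ) ^ (r - 1))
            * (a₁ + a₂ * (q.2.1 : ℂ) + a₃ * (q.2.2.1 : ℂ) + a₄ * (q.2.2.2 : ℂ)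
                + a₅ * (q.2.2.1 : ℂ) * (q.2.2.2 : ℂ))) p ≠ 0)) ∧
    (α = -1 →
      (∀ p, tension48Iter α r
          (fun q => (c₁ * (q.1 : ℂ) ^ (2 * r - 1) + c₂ * (q.1 : ℂ) ^ (2 * r - 2))
            * (a₁ + a₂ * (q.2.1 : ℂ) + a₃ * (q.2.2.1 : ℂ) + a₄ * (q.2.2.2 : ℂ)
                + a₅ * (q.2.2.1 : ℂ) * (q.2.2.2 : ℂ))) p = 0) ∧
      (∃ p, tension48Iter α (r - 1)
          (fun q => (c₁ * (q.1 : ℂ) ^ (2 * r - 1) + c₂ * (q.1 : ℂ) ^ (2 * r - 2))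
            * (a₁ + a₂ * (q.2.1 : ℂ) + a₃ * (q.2.2.1 : ℂ) + a₄ * (q.2.2.2 : ℂ)
                + a₅ * (q.2.2.1 : ℂ) * (q.2.2.2 : ℂ))) p ≠ 0)) := by
  obtain ⟨n, rfl⟩ : ∃ n, r = n + 1 := ⟨r - 1, by omega⟩
  obtain ⟨y, hy⟩ := exists_spatialFactor_ne_zero ha
  have hn : ((n.factorial : ℕ) : ℂ) ≠ 0 := by exact_mod_cast n.factorial_ne_zero
  constructor
  · intro hα_ne
    have hκ : (2 * (1 + α)) ≠ 0 := by
      intro h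
      exact hα_ne (by linarith)
    have hκ_ne : ((2 * (1 + α) : ℝ) : ℂ) ≠ 0 := by exact_mod_cast hκ
    have hF : (fun q : ℝ × ℝ × ℝ × ℝ =>
        (c₁ * (q.1 : ℂ) ^ (n + 1 - 1) * (Real.exp (2 * (1 + α) * q.1) : ℂ)
              + c₂ * (q.1 : ℂ) ^ (n + 1 - 1))
            * (a₁ + a₂ * (q.2.1 : ℂ) + a₃ * (q.2.2.1 : ℂ) + a₄ * (q.2.2.2 : ℂ)
                + a₅ * (q.2.2.1 : ℂ) * (q.2.2.2 : ℂ))) =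
        fun q => expPoly (2 * (1 + α)) (c₁ • X ^ n) (c₂ • X ^ n) q.1
          * spatialFactor a₁ a₂ a₃ a₄ a₅ q := by
      funext q
      simp [expPoly, spatialFactor]
    have hdeg : (X ^ n : ℂ[X]).degree < (n + 1 : ℕ) := by
      rw [degree_X_pow]
      exact_mod_cast n.lt_succ_self
    rw [hF, tension48Iter_expPoly, tension48Iter_expPoly]
    simp only [map_smul, derivTwist_pow_eq_zero _ hdeg, Nat.add_sub_cancel, derivTwist_pow_X_pow]
    refine ⟨fun p => by simp [expPoly], ?_⟩
    obtain ⟨t, ht⟩ := exists_mul_exp_add_ne_zero hκ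
      (b₁ := c₁ * (((2 * (1 + α) : ℝ) : ℂ) ^ n * n.factorial))
      (b₂ := c₂ * ((-((2 * (1 + α) : ℝ) : ℂ)) ^ n * n.factorial))
      (by simpa only [mul_eq_zero, pow_eq_zero_iff', neg_eq_zero, hκ_ne, hn, false_and, or_false]
        using hc)
    refine ⟨(t, y), mul_ne_zero ?_ (hy t)⟩
    simpa only [expPoly, smul_eq_C_mul, eval_mul, eval_C] using ht
  · rintro rfl
    have hF : (fun q : ℝ × ℝ × ℝ × ℝ =>
        (c₁ * (q.1 : ℂ) ^ (2 * (n + 1) - 1) + c₂ * (q.1 : ℂ) ^ (2 * (n + 1) - 2))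
            * (a₁ + a₂ * (q.2.1 : ℂ) + a₃ * (q.2.2.1 : ℂ) + a₄ * (q.2.2.2 : ℂ)
                + a₅ * (q.2.2.1 : ℂ) * (q.2.2.2 : ℂ))) =
        fun q => expPoly (2 * (1 + -1)) 0 (c₁ • X ^ (2 * n + 1) + c₂ • X ^ (2 * n)) q.1
          * spatialFactor a₁ a₂ a₃ a₄ a₅ q := by
      funext q
      simp [expPoly, spatialFactor, show 2 * (n + 1) - 1 = 2 * n + 1 by omega,
        show 2 * (n + 1) - 2 = 2 * n by omega]
    have hκ : -((2 * (1 + -1) : ℝ) : ℂ) = 0 := by norm_num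
    rw [hF, tension48Iter_expPoly, tension48Iter_expPoly, hκ]
    simp only [map_zero, derivTwist_zero_pow, Nat.add_sub_cancel]
    constructor
    · intro p
      rw [iterate_derivative_eq_zero_of_degree_lt]
      · simp [expPoly]
      · refine (degree_add_le _ _).trans_lt (max_lt ?_ ?_)
        all_goals
          refine (degree_smul_le _ _).trans_lt ?_
          rw [degree_X_pow]
          norm_cast
          omega
    · obtain ⟨t, ht⟩ := exists_mul_add_ne_zero
        (b₁ := c₁ * ((2 * n + 1).factorial : ℕ)) (b₂ := c₂ * ((2 * n).factorial : ℕ))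
        (by simpa [Nat.factorial_ne_zero] using hc)
      refine ⟨(t, y), mul_ne_zero ?_ (hy t)⟩
      convert ht using 1
      have hd : (2 * n + 1).descFactorial (2 * n) = (2 * n + 1).factorial := by
        rw [← Nat.descFactorial_self (2 * n + 1), Nat.descFactorial_succ,
          Nat.add_sub_cancel_left, one_mul]
      simp [expPoly, iterate_derivative_X_pow_eq_smul, iterate_derivative_smul,
        Nat.descFactorial_self, hd, mul_assoc]
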